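/- Let x₀, x₁ be unit vectors in ℝ^{d+1} with x₁ ≠ x₀ and x₁ ≠ −x₀, let θ = arccos⟨x₀, x₁⟩ ∈ (0, π), and let γ(t) = (sin((1−t)θ)/sin θ) x₀ + (sin(tθ)/sin θ) x₁. Then for every t ∈ [0, 1), the flow-matching target velocity equals the geodesic velocity: (1/(1−t)) · Log_{γ(t)}(x₁) = γ̇(t), where Log_p(q) = (θ_{pq}/sin θ_{pq})(q − ⟨p, q⟩ p) with θ_{pq} = arccos⟨p, q⟩ (this is well defined since the angle between γ(t) and x₁ is (1−t)θ ∈ (0, π)). -/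

import Mathlib

open scoped RealInnerProductSpace

/-- **The flow-matching target velocity equals the geodesic velocity.**
For unit vectors `x₀ ≠ ±x₁` in `ℝ^{d+1}`, with `θ = arccos ⟪x₀, x₁⟫` and
`γ t = (sin((1-t)θ)/sin θ) • x₀ + (sin(tθ)/sin θ) • x₁`, for every
`t ∈ [0, 1)` we have `(1/(1-t)) • Log_{γ t}(x₁) = γ̇(t)`, where
`Log_p(q) = (θ_{pq} / sin θ_{pq}) • (q - ⟪p, q⟫ • p)` with
`θ_{pq} = arccos ⟪p, q⟫` (well defined since the angle between `γ t` and
`x₁` is `(1-t)θ ∈ (0, π)`). -/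
theorem flow_matching_target_eq_geodesic_velocity
    {d : ℕ} (x₀ x₁ : EuclideanSpace ℝ (Fin (d + 1)))
    (hx₀ : ‖x₀‖ = 1) (hx₁ : ‖x₁‖ = 1) (hne : x₁ ≠ x₀) (hne' : x₁ ≠ -x₀)
    (θ : ℝ) (hθ : θ = Real.arccos ⟪x₀, x₁⟫)
    (γ : ℝ → EuclideanSpace ℝ (Fin (d + 1)))
    (hγ : ∀ t : ℝ, γ t = (Real.sin ((1 - t) * θ) / Real.sin θ) • x₀ +
      (Real.sin (t * θ) / Real.sin θ) • x₁) :
    ∀ t ∈ Set.Ico (0 : ℝ) 1,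
      (1 / (1 - t)) •
        ((Real.arccos ⟪γ t, x₁⟫ / Real.sin (Real.arccos ⟪γ t, x₁⟫)) •
          (x₁ - ⟪γ t, x₁⟫ • γ t)) = deriv γ t := by
  rintro t ⟨ht0, ht1⟩
  have hcos : Real.cos θ = ⟪x₀, x₁⟫ := by
    rw [hθ, Real.cos_arccos (neg_one_le_real_inner_of_norm_eq_one hx₀ hx₁)
      (real_inner_le_one_of_norm_eq_one hx₀ hx₁)]
  have hlt : ⟪x₀, x₁⟫ < 1 := inner_lt_one_iff_real_of_norm_eq_one hx₀ hx₁ |>.2 hne.symm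
  have hgt : -1 < ⟪x₀, x₁⟫ := by
    have h := inner_lt_one_iff_real_of_norm_eq_one hx₀ (y := -x₁) (by rwa [norm_neg]) |>.2
      fun h => hne' (by rw [h, neg_neg])
    rw [inner_neg_right] at h
    linarith
  have hθ0 : 0 < θ := hθ ▸ Real.arccos_pos.2 hlt
  have hθπ : θ < Real.pi := by
    rw [hθ]
    exact (Real.arccos_le_pi _).lt_of_ne fun h => hgt.not_ge (Real.arccos_eq_pi.1 h)
  have hsθ : Real.sin θ ≠ 0 := (Real.sin_pos_of_pos_of_lt_pi hθ0 hθπ).ne'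
  have ht : 1 - t ≠ 0 := by linarith
  have ha0 : 0 < (1 - t) * θ := mul_pos (by linarith) hθ0
  have haπ : (1 - t) * θ < Real.pi := by nlinarith
  have hsa : Real.sin ((1 - t) * θ) ≠ 0 := (Real.sin_pos_of_pos_of_lt_pi ha0 haπ).ne'
  have htθ : t * θ = θ - (1 - t) * θ := by ring
  have hinner : ⟪γ t, x₁⟫ = Real.cos ((1 - t) * θ) := by
    rw [hγ, inner_add_left, real_inner_smul_left, real_inner_smul_left, ← hcos,
      real_inner_self_eq_norm_sq, hx₁, htθ, Real.sin_sub]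
    field_simp
    ring
  have hderiv : HasDerivAt γ ((-(θ * Real.cos ((1 - t) * θ)) / Real.sin θ) • x₀ +
      (θ * Real.cos (t * θ) / Real.sin θ) • x₁) t := by
    rw [funext hγ]
    have h₀ : HasDerivAt (fun s : ℝ => Real.sin ((1 - s) * θ) / Real.sin θ)
        (-(θ * Real.cos ((1 - t) * θ)) / Real.sin θ) t := by
      refine ((((hasDerivAt_id' t).const_sub 1).mul_const θ).sin.div_const (Real.sin θ)).congr_deriv ?_
      ring
    have h₁ : HasDerivAt (fun s : ℝ => Real.sin (s * θ) / Real.sin θ)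
        (θ * Real.cos (t * θ) / Real.sin θ) t := by
      refine ((((hasDerivAt_id' t).mul_const θ).sin).div_const (Real.sin θ)).congr_deriv ?_
      ring
    exact (h₀.smul_const x₀).add (h₁.smul_const x₁)
  rw [hderiv.deriv, hinner, Real.arccos_cos ha0.le haπ.le, hγ, htθ, Real.sin_sub, Real.cos_sub]
  match_scalars
  · field_simp
    linear_combination -Real.sin θ * Real.sin_sq_add_cos_sq ((1 - t) * θ)
  · field_simp
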